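/- arXiv:math/0505427 — 2 statements merged into one kernel-verified Lean document; each statement's English description precedes it below -/
import Mathlib

section
/- Let Z be a bounded metric space. Then the hyperbolic cone Y = Co(Z) is a δ-hyperbolic space with δ = δ(H²) the hyperbolicity constant of the hyperbolic plane: for all y, y', y'' ∈ Y the three Gromov products (y|y')_o, (y|y'')_o, (y'|y'')_o with respect to the vertex o form a δ-triple. -/
open Set

noncomputable section

universe u v

/-- The Gromov product of `x`, `y` with respect to `o`. -/
def gromovProd {X : Type*} [MetricSpace X] (o x y : X) : ℝ :=
  (dist x o + dist y o - dist x y) / 2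

/-- A `δ`-triple: the two smallest of the three numbers differ by at most `δ`. -/
def IsDeltaTriple (δ a b c : ℝ) : Prop :=
  min a b - δ ≤ c ∧ min a c - δ ≤ b ∧ min b c - δ ≤ a

open Real in
/-- The point of the upper half plane with polar coordinates `(t, φ)` around `I`. -/
def polarPoint (t φ : ℝ) : UpperHalfPlane :=
  ⟨⟨sinh t * sin φ / (cosh t - sinh t * cos φ), (cosh t - sinh t * cos φ)⁻¹⟩, by
    have h1 := Real.cosh_sq t
    have h2 : 0 < cosh t := Real.cosh_pos t
    have h3 := Real.sin_sq_add_cos_sq φ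
    have h4 : |sinh t * cos φ| < cosh t := by
      apply abs_lt_of_sq_lt_sq _ h2.le
      nlinarith [sq_nonneg (sinh t * sin φ)]
    exact inv_pos.2 (sub_pos.2 (abs_lt.1 h4).2)⟩

open Real in
lemma cosh_dist_polarPoint (t φ t' φ' : ℝ) :
    cosh (dist (polarPoint t φ) (polarPoint t' φ')) =
      cosh t * cosh t' - sinh t * sinh t' * cos (φ - φ') := by
  have hD : 0 < (cosh t - sinh t * cos φ)⁻¹ := (polarPoint t φ).im_pos
  have hD' : 0 < (cosh t' - sinh t' * cos φ')⁻¹ := (polarPoint t' φ').im_pos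
  have hne := (inv_pos.1 hD).ne'
  have hne' := (inv_pos.1 hD').ne'
  have key : (sinh t * sin φ) ^ 2 + 1 =
      (cosh t - sinh t * cos φ) * (cosh t + sinh t * cos φ) := by
    linear_combination sinh t ^ 2 * sin_sq_add_cos_sq φ - Real.cosh_sq t
  have key' : (sinh t' * sin φ') ^ 2 + 1 =
      (cosh t' - sinh t' * cos φ') * (cosh t' + sinh t' * cos φ') := by
    linear_combination sinh t' ^ 2 * sin_sq_add_cos_sq φ' - Real.cosh_sq t'
  rw [UpperHalfPlane.cosh_dist, Complex.dist_eq, Complex.sq_norm, Complex.normSq_apply, cos_sub]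
  change 1 + ((sinh t * sin φ / (cosh t - sinh t * cos φ) -
      sinh t' * sin φ' / (cosh t' - sinh t' * cos φ')) *
      (sinh t * sin φ / (cosh t - sinh t * cos φ) -
      sinh t' * sin φ' / (cosh t' - sinh t' * cos φ')) +
      ((cosh t - sinh t * cos φ)⁻¹ - (cosh t' - sinh t' * cos φ')⁻¹) *
      ((cosh t - sinh t * cos φ)⁻¹ - (cosh t' - sinh t' * cos φ')⁻¹)) /
      (2 * (cosh t - sinh t * cos φ)⁻¹ * (cosh t' - sinh t' * cos φ')⁻¹) = _
  generalize hX : sinh t * cos φ = X at *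
  generalize hX' : sinh t' * cos φ' = X' at *
  generalize hY : sinh t * sin φ = V at *
  generalize hY' : sinh t' * sin φ' = V' at *
  have hR : sinh t * sinh t' * (cos φ * cos φ' + sin φ * sin φ') = X * X' + V * V' := by
    rw [← hX, ← hX', ← hY, ← hY']; ring
  rw [hR]
  field_simp
  linear_combination (cosh t' - X') ^ 2 * key + (cosh t - X) ^ 2 * key'

open Real in
lemma dist_polarPoint_zero (t φ φ' : ℝ) (ht : 0 ≤ t) :
    dist (polarPoint t φ) (polarPoint 0 φ') = t := by
  have h := cosh_dist_polarPoint t φ 0 φ'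
  rw [Real.cosh_zero, Real.sinh_zero, mul_one, mul_zero, zero_mul, sub_zero] at h
  exact Real.cosh_injOn dist_nonneg ht h

open Real in
/-- In hyperbolic hinges with the same sides, the third side is monotone in the angle. -/
lemma le_of_hinge {t t' d e α β : ℝ} (ht : 0 ≤ t) (ht' : 0 ≤ t') (hd : 0 ≤ d) (he : 0 ≤ e)
    (hα : 0 ≤ α) (hβ : β ≤ π) (hαβ : α ≤ β)
    (hcd : cosh d = cosh t * cosh t' - sinh t * sinh t' * cos α)
    (hce : cosh e = cosh t * cosh t' - sinh t * sinh t' * cos β) : d ≤ e := by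
  have hcos := Real.cos_le_cos_of_nonneg_of_le_pi hα hβ hαβ
  have hs := mul_nonneg (Real.sinh_nonneg_iff.2 ht) (Real.sinh_nonneg_iff.2 ht')
  have hle : cosh d ≤ cosh e := by
    rw [hcd, hce]; linarith [mul_le_mul_of_nonneg_left hcos hs]
  simpa [abs_of_nonneg hd, abs_of_nonneg he] using Real.cosh_le_cosh.1 hle

open Real in
/-- The hyperbolicity inequality for three hyperbolic hinges at a common vertex whose angles
satisfy the triangle inequality. -/
lemma min_sub_le_of_hinges {δ : ℝ}
    (hH2 : ∀ o x y z : UpperHalfPlane,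
      min (gromovProd o x y) (gromovProd o y z) - δ ≤ gromovProd o x z)
    {t₁ t₂ t₃ a₁₂ a₂₃ a₁₃ d₁₂ d₂₃ d₁₃ : ℝ} (ht₁ : 0 ≤ t₁) (ht₂ : 0 ≤ t₂) (ht₃ : 0 ≤ t₃)
    (ha₁₂ : 0 ≤ a₁₂) (ha₂₃ : 0 ≤ a₂₃) (ha₁₃ : 0 ≤ a₁₃)
    (hπ₁₂ : a₁₂ ≤ π) (hπ₂₃ : a₂₃ ≤ π) (hπ₁₃ : a₁₃ ≤ π) (htri : a₁₃ ≤ a₁₂ + a₂₃)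
    (hd₁₂ : 0 ≤ d₁₂) (hd₂₃ : 0 ≤ d₂₃) (hd₁₃ : 0 ≤ d₁₃)
    (h₁₂ : cosh d₁₂ = cosh t₁ * cosh t₂ - sinh t₁ * sinh t₂ * cos a₁₂)
    (h₂₃ : cosh d₂₃ = cosh t₂ * cosh t₃ - sinh t₂ * sinh t₃ * cos a₂₃)
    (h₁₃ : cosh d₁₃ = cosh t₁ * cosh t₃ - sinh t₁ * sinh t₃ * cos a₁₃) :
    min ((t₁ + t₂ - d₁₂) / 2) ((t₂ + t₃ - d₂₃) / 2) - δ ≤ (t₁ + t₃ - d₁₃) / 2 := by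
  obtain ⟨b, hb₀, hb, hbπ, hb₁₃⟩ : ∃ b, 0 ≤ b ∧ b ≤ a₂₃ ∧ a₁₂ + b ≤ π ∧ a₁₃ ≤ a₁₂ + b := by
    rcases le_total (a₁₂ + a₂₃) π with h | h
    · exact ⟨a₂₃, ha₂₃, le_rfl, h, htri⟩
    · exact ⟨π - a₁₂, by linarith, by linarith, by linarith, by linarith⟩
  have e₁₂ := cosh_dist_polarPoint t₁ (a₁₂ + b) t₂ b
  have e₂₃ := cosh_dist_polarPoint t₂ b t₃ 0
  have e₁₃ := cosh_dist_polarPoint t₁ (a₁₂ + b) t₃ 0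
  rw [add_sub_cancel_right] at e₁₂
  rw [sub_zero] at e₂₃ e₁₃
  have l₁₂ := le_of_hinge ht₁ ht₂ dist_nonneg hd₁₂ ha₁₂ hπ₁₂ le_rfl e₁₂ h₁₂
  have l₂₃ := le_of_hinge ht₂ ht₃ dist_nonneg hd₂₃ hb₀ hπ₂₃ hb e₂₃ h₂₃
  have l₁₃ := le_of_hinge ht₁ ht₃ hd₁₃ dist_nonneg ha₁₃ hbπ hb₁₃ h₁₃ e₁₃
  have key := hH2 (polarPoint 0 0) (polarPoint t₁ (a₁₂ + b)) (polarPoint t₂ b) (polarPoint t₃ 0)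
  simp only [gromovProd, dist_polarPoint_zero _ _ _ ht₁, dist_polarPoint_zero _ _ _ ht₂,
    dist_polarPoint_zero _ _ _ ht₃] at key
  refine (sub_le_sub_right (min_le_min ?_ ?_) δ).trans (key.trans ?_) <;> linarith

open Real in
/-- **Proposition 6.1 (first part).** Let `Z` be a bounded metric space. Then the
hyperbolic cone `Y = Co(Z)` is `δ`-hyperbolic with `δ = δ(H²)` a hyperbolicity constant
of the hyperbolic plane: the pairwise Gromov products of any three points of `Y` with
respect to the vertex `o = c z₀ 0` form a `δ`-triple. -/
theorem hyperbolicCone_hyperbolic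
    {Z : Type u} [MetricSpace Z] (hbdd : Bornology.IsBounded (univ : Set Z))
    {Y : Type v} [MetricSpace Y] (c : Z → ℝ → Y)
    (hsurj : ∀ y : Y, ∃ z t, 0 ≤ t ∧ c z t = y)
    (hformula : ∀ (z z' : Z) (t t' : ℝ), 0 ≤ t → 0 ≤ t' →
      Real.cosh (dist (c z t) (c z' t')) =
        Real.cosh t * Real.cosh t' -
          Real.sinh t * Real.sinh t' *
            Real.cos (π / Metric.diam (univ : Set Z) * dist z z'))
    (δ : ℝ) (hδ : 0 ≤ δ)
    (hH2 : ∀ o x y z : UpperHalfPlane,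
      min (gromovProd o x y) (gromovProd o y z) - δ ≤ gromovProd o x z) :
    ∀ (z₀ : Z) (y y' y'' : Y),
      IsDeltaTriple δ (gromovProd (c z₀ 0) y y') (gromovProd (c z₀ 0) y y'')
        (gromovProd (c z₀ 0) y' y'') := by
  intro z₀ y y' y''
  have hang : ∀ z z' : Z, 0 ≤ π / Metric.diam (univ : Set Z) * dist z z' ∧
      π / Metric.diam (univ : Set Z) * dist z z' ≤ π := by
    intro z z'
    have hdist := Metric.dist_le_diam_of_mem hbdd (mem_univ z) (mem_univ z')
    have hdiam : 0 ≤ Metric.diam (univ : Set Z) := Metric.diam_nonneg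
    refine ⟨by positivity, ?_⟩
    rw [div_mul_eq_mul_div]
    exact div_le_of_le_mul₀ hdiam pi_pos.le (mul_le_mul_of_nonneg_left hdist pi_pos.le)
  have hvertex : ∀ z t, 0 ≤ t → dist (c z t) (c z₀ 0) = t := by
    intro z t ht
    have h := hformula z z₀ t 0 ht le_rfl
    rw [Real.cosh_zero, Real.sinh_zero, mul_one, mul_zero, zero_mul, sub_zero] at h
    exact Real.cosh_injOn dist_nonneg ht h
  have main : ∀ x₁ x₂ x₃ : Y, min (gromovProd (c z₀ 0) x₁ x₂) (gromovProd (c z₀ 0) x₂ x₃) - δ ≤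
      gromovProd (c z₀ 0) x₁ x₃ := by
    intro x₁ x₂ x₃
    obtain ⟨z₁, t₁, ht₁, rfl⟩ := hsurj x₁
    obtain ⟨z₂, t₂, ht₂, rfl⟩ := hsurj x₂
    obtain ⟨z₃, t₃, ht₃, rfl⟩ := hsurj x₃
    simp only [gromovProd, hvertex _ _ ht₁, hvertex _ _ ht₂, hvertex _ _ ht₃]
    refine min_sub_le_of_hinges hH2 ht₁ ht₂ ht₃ (hang z₁ z₂).1 (hang z₂ z₃).1 (hang z₁ z₃).1
      (hang z₁ z₂).2 (hang z₂ z₃).2 (hang z₁ z₃).2 ?_ dist_nonneg dist_nonneg dist_nonneg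
      (hformula _ _ _ _ ht₁ ht₂) (hformula _ _ _ _ ht₂ ht₃) (hformula _ _ _ _ ht₁ ht₃)
    rw [← mul_add]
    exact mul_le_mul_of_nonneg_left (dist_triangle _ _ _)
      (div_nonneg pi_pos.le Metric.diam_nonneg)
  have hcomm : ∀ x x' : Y, gromovProd (c z₀ 0) x x' = gromovProd (c z₀ 0) x' x := by
    intro x x'
    rw [gromovProd, gromovProd, dist_comm x x', add_comm (dist x _)]
  refine ⟨?_, ?_, ?_⟩
  · rw [hcomm y y']
    exact main y' y y''
  · exact main y y' y''
  · rw [hcomm y' y'']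
    exact main y y'' y'
end
end

section
/- Let Z be a bounded metric space with diam Z > 0, Y = Co(Z) its hyperbolic cone with vertex o, and δ = δ(H²). For z ∈ Z let the geodesic ray {z} × [0,∞) ⊂ Y define the point z ∈ ∂∞Y, giving a canonical inclusion Z ⊂ ∂∞Y. Then for all z, z' ∈ Z: e^{−3δ}·e^{−(z|z')_o} ≤ tan(μ|zz'|/4) ≤ e^{−(z|z')_o}, where (z|z')_o is the Gromov product in Y of the boundary points z, z' with respect to o and μ = π/diam Z; consequently the metric of Z is a visual metric on Z ⊂ ∂∞Y with respect to the base point o and the parameter a = e. Moreover, if Z is complete then ∂∞Y = Z. -/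
open Set Filter Metric ENNReal

noncomputable section

universe u v w

/-- A sequence converges to infinity. -/
def ConvInf {X : Type*} [MetricSpace X] (o : X) (u : ℕ → X) : Prop :=
  Filter.Tendsto (fun p : ℕ × ℕ => gromovProd o (u p.1) (u p.2)) Filter.atTop Filter.atTop

/-- Equivalence of sequences converging to infinity. -/
def BdryRel {X : Type*} [MetricSpace X] (o : X) (u v : {u : ℕ → X // ConvInf o u}) : Prop :=
  Filter.Tendsto (fun i => gromovProd o (u.1 i) (v.1 i)) Filter.atTop Filter.atTop

/-- The boundary at infinity of `X` (with respect to the base point `o`). -/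
def Bdry (X : Type u) [MetricSpace X] (o : X) : Type u := Quot (BdryRel o)

/-- The Gromov product of two boundary points. -/
def gpBdry {X : Type u} [MetricSpace X] (o : X) (ξ ξ' : Bdry X o) : ℝ≥0∞ :=
  ⨅ (u : {u : ℕ → X // ConvInf o u}) (_ : Quot.mk (BdryRel o) u = ξ)
    (v : {u : ℕ → X // ConvInf o u}) (_ : Quot.mk (BdryRel o) v = ξ'),
    Filter.liminf (fun i => ENNReal.ofReal (gromovProd o (u.1 i) (v.1 i))) Filter.atTop

/-- The Gromov product of a point and a boundary point. -/
def gpPtBdry {X : Type u} [MetricSpace X] (o : X) (x : X) (ξ : Bdry X o) : ℝ≥0∞ :=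
  ⨅ (u : {u : ℕ → X // ConvInf o u}) (_ : Quot.mk (BdryRel o) u = ξ),
    Filter.liminf (fun i => ENNReal.ofReal (gromovProd o x (u.1 i))) Filter.atTop

/-- `a^{-p}` for `p ∈ [0,∞]`, used in the definition of visual metrics. -/
def visualGauge (a : ℝ) (p : ℝ≥0∞) : ℝ≥0∞ :=
  if p = ⊤ then 0 else ENNReal.ofReal (a ^ (-p.toReal))

/-- `c` gives polar coordinates on a hyperbolic cone over `Z`, with angles scaled by `π / D`. -/
structure IsHyperbolicCone {Z : Type u} [MetricSpace Z] {Y : Type v} [MetricSpace Y]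
    (D : ℝ) (c : Z → ℝ → Y) : Prop where
  pos : 0 < D
  dist_le : ∀ z z' : Z, dist z z' ≤ D
  surj : ∀ y : Y, ∃ z t, 0 ≤ t ∧ c z t = y
  cosh_dist : ∀ (z z' : Z) (t t' : ℝ), 0 ≤ t → 0 ≤ t' →
    Real.cosh (dist (c z t) (c z' t')) = Real.cosh t * Real.cosh t' -
      Real.sinh t * Real.sinh t' * Real.cos (Real.pi / D * dist z z')

namespace IsHyperbolicCone

/-- The sine of half the angle between two directions. -/
def halfSin {Z : Type u} [MetricSpace Z] (D : ℝ) (z z' : Z) : ℝ :=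
  Real.sin (Real.pi / D * dist z z' / 2)

variable {Z : Type u} [MetricSpace Z] {Y : Type v} [MetricSpace Y] {D : ℝ} {c : Z → ℝ → Y}

lemma angle_nonneg (h : IsHyperbolicCone D c) (z z' : Z) : 0 ≤ Real.pi / D * dist z z' := by
  have := h.pos
  positivity

lemma angle_le_pi (h : IsHyperbolicCone D c) (z z' : Z) :
    Real.pi / D * dist z z' ≤ Real.pi := by
  have hD := h.pos
  calc Real.pi / D * dist z z' ≤ Real.pi / D * D := by gcongr; exact h.dist_le z z'
    _ = Real.pi := by field_simp

lemma halfSin_nonneg (h : IsHyperbolicCone D c) (z z' : Z) : 0 ≤ halfSin D z z' :=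
  Real.sin_nonneg_of_nonneg_of_le_pi (by linarith [h.angle_nonneg z z'])
    (by linarith [h.angle_nonneg z z', h.angle_le_pi z z'])

lemma dist_le_mul_halfSin (h : IsHyperbolicCone D c) (z z' : Z) :
    dist z z' ≤ D * halfSin D z z' := by
  have hD := h.pos
  have := Real.mul_le_sin (x := Real.pi / D * dist z z' / 2) (by linarith [h.angle_nonneg z z'])
    (by linarith [h.angle_le_pi z z'])
  calc dist z z' = D * (2 / Real.pi * (Real.pi / D * dist z z' / 2)) := by
        field_simp
    _ ≤ _ := by unfold halfSin; gcongr

lemma halfSin_le (h : IsHyperbolicCone D c) (z z' : Z) :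
    halfSin D z z' ≤ Real.pi / D / 2 * dist z z' := by
  have := Real.sin_le (x := Real.pi / D * dist z z' / 2) (by linarith [h.angle_nonneg z z'])
  unfold halfSin
  linarith

lemma dist_vertex (h : IsHyperbolicCone D c) (z z₀ : Z) {t : ℝ} (ht : 0 ≤ t) :
    dist (c z t) (c z₀ 0) = t := by
  have := h.cosh_dist z z₀ t 0 ht le_rfl
  simp only [Real.cosh_zero, Real.sinh_zero, mul_one, mul_zero, zero_mul, sub_zero] at this
  exact Real.cosh_injOn (mem_Ici.2 dist_nonneg) (mem_Ici.2 ht) this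

lemma gromovProd_self {X : Type*} [MetricSpace X] (o x : X) : gromovProd o x x = dist x o := by
  simp [gromovProd]

lemma abs_exp_gromovProd_sub_le (h : IsHyperbolicCone D c) (z₀ z z' : Z) {t t' : ℝ}
    (ht : 0 ≤ t) (ht' : 0 ≤ t') :
    |Real.exp (-2 * gromovProd (c z₀ 0) (c z t) (c z' t')) - halfSin D z z' ^ 2| ≤
      Real.exp (-t) ^ 2 + Real.exp (-t') ^ 2 := by
  have hf := h.cosh_dist z z' t t' ht ht'
  have hs : Real.cos (Real.pi / D * dist z z') = 1 - 2 * halfSin D z z' ^ 2 := by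
    have h1 := Real.cos_two_mul (Real.pi / D * dist z z' / 2)
    have h2 := Real.sin_sq_add_cos_sq (Real.pi / D * dist z z' / 2)
    rw [show 2 * (Real.pi / D * dist z z' / 2) = Real.pi / D * dist z z' by ring] at h1
    unfold halfSin
    linarith
  have hs1 : halfSin D z z' ^ 2 ≤ 1 := Real.sin_sq_le_one _
  have hs0 : 0 ≤ halfSin D z z' ^ 2 := sq_nonneg _
  rw [hs] at hf
  have hG : -2 * gromovProd (c z₀ 0) (c z t) (c z' t') = dist (c z t) (c z' t') + -t + -t' := by
    rw [gromovProd, h.dist_vertex z z₀ ht, h.dist_vertex z' z₀ ht']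
    ring
  rw [hG, Real.exp_add, Real.exp_add]
  generalize halfSin D z z' ^ 2 = S at *
  have hd : 0 ≤ dist (c z t) (c z' t') := dist_nonneg
  generalize dist (c z t) (c z' t') = d at *
  rw [Real.cosh_eq, Real.cosh_eq, Real.cosh_eq, Real.sinh_eq, Real.sinh_eq] at hf
  have ha0 := Real.exp_pos (-t)
  have hb0 := Real.exp_pos (-t')
  have ha1 : Real.exp (-t) ≤ 1 := Real.exp_le_one_iff.2 (by linarith)
  have hb1 : Real.exp (-t') ≤ 1 := Real.exp_le_one_iff.2 (by linarith)
  have hd1 : Real.exp (-d) ≤ 1 := Real.exp_le_one_iff.2 (by linarith)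
  have hd0 := Real.exp_pos (-d)
  have ea : Real.exp t * Real.exp (-t) = 1 := by rw [← Real.exp_add]; simp
  have eb : Real.exp t' * Real.exp (-t') = 1 := by rw [← Real.exp_add]; simp
  generalize Real.exp (-t) = a at *
  generalize Real.exp (-t') = b at *
  generalize Real.exp (-d) = k at *
  generalize Real.exp t = A at *
  generalize Real.exp t' = B at *
  generalize Real.exp d = E at *
  have key : E * a * b = a ^ 2 + b ^ 2 + (1 - a ^ 2) * (1 - b ^ 2) * S - k * (a * b) := by
    have hf2 : E + k = A * b + a * B + (A - a) * (B - b) * S := by linarith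
    have hE : E = A * b + a * B + (A - a) * (B - b) * S - k := by linarith
    have e1 : E * a * b = (A * a) * b ^ 2 + (B * b) * a ^ 2
        + (A * a - a ^ 2) * (B * b - b ^ 2) * S - k * (a * b) := by rw [hE]; ring
    rw [e1, ea, eb]; ring
  have hab : k * (a * b) ≤ a ^ 2 + b ^ 2 := by
    have : k * (a * b) ≤ a * b := by
      have : 0 < a * b := by positivity
      nlinarith
    nlinarith [sq_nonneg (a - b), sq_nonneg a, sq_nonneg b]
  have hkab : 0 < k * (a * b) := by positivity
  have ha2 : a ^ 2 ≤ 1 := pow_le_one₀ ha0.le ha1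
  have hb2 : b ^ 2 ≤ 1 := pow_le_one₀ hb0.le hb1
  have hp : 0 ≤ a ^ 2 * b ^ 2 * S := by positivity
  have hq : (1 - a ^ 2) * (1 - b ^ 2) * S ≤ S := by
    have : (1 - a ^ 2) * (1 - b ^ 2) ≤ 1 := by nlinarith [sq_nonneg a, sq_nonneg b]
    nlinarith
  have hr : a ^ 2 * S ≤ a ^ 2 := by nlinarith [sq_nonneg a]
  have hr' : b ^ 2 * S ≤ b ^ 2 := by nlinarith [sq_nonneg b]
  rw [key, abs_le]
  constructor
  · nlinarith
  · linarith

section Limits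

variable {α : Type*} {l : Filter α} {z z' : α → Z} {t t' : α → ℝ}

lemma tendsto_exp_gromovProd_sub (h : IsHyperbolicCone D c) (z₀ : Z)
    (h0 : ∀ i, 0 ≤ t i) (h0' : ∀ i, 0 ≤ t' i)
    (ht : Tendsto t l atTop) (ht' : Tendsto t' l atTop) :
    Tendsto (fun i => Real.exp (-2 * gromovProd (c z₀ 0) (c (z i) (t i)) (c (z' i) (t' i))) -
      halfSin D (z i) (z' i) ^ 2) l (nhds 0) := by
  have e : ∀ {f : α → ℝ}, Tendsto f l atTop →
      Tendsto (fun i => Real.exp (-f i) ^ 2) l (nhds 0) := fun hf => by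
    simpa using ((Real.tendsto_exp_neg_atTop_nhds_zero.comp hf).pow 2)
  refine squeeze_zero_norm (fun i => ?_) (by simpa using (e ht).add (e ht'))
  exact h.abs_exp_gromovProd_sub_le z₀ _ _ (h0 i) (h0' i)

lemma tendsto_gromovProd_atTop_iff (h : IsHyperbolicCone D c) (z₀ : Z)
    (h0 : ∀ i, 0 ≤ t i) (h0' : ∀ i, 0 ≤ t' i)
    (ht : Tendsto t l atTop) (ht' : Tendsto t' l atTop) :
    Tendsto (fun i => gromovProd (c z₀ 0) (c (z i) (t i)) (c (z' i) (t' i))) l atTop ↔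
      Tendsto (fun i => dist (z i) (z' i)) l (nhds 0) := by
  have hE := h.tendsto_exp_gromovProd_sub (z := z) (z' := z') z₀ h0 h0' ht ht'
  constructor
  · intro hG
    have h1 : Tendsto (fun i => Real.exp
        (-2 * gromovProd (c z₀ 0) (c (z i) (t i)) (c (z' i) (t' i)))) l (nhds 0) :=
      Real.tendsto_exp_atBot.comp (hG.const_mul_atTop_of_neg (by norm_num))
    have h2 : Tendsto (fun i => halfSin D (z i) (z' i) ^ 2) l (nhds 0) := by
      simpa using h1.sub hE
    have h3 : Tendsto (fun i => halfSin D (z i) (z' i)) l (nhds 0) := by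
      have := h2.sqrt
      simpa only [Real.sqrt_sq (h.halfSin_nonneg _ _), Real.sqrt_zero] using this
    exact squeeze_zero (fun _ => dist_nonneg) (fun _ => h.dist_le_mul_halfSin _ _)
      (by simpa using h3.const_mul D)
  · intro hd
    have h3 : Tendsto (fun i => halfSin D (z i) (z' i)) l (nhds 0) :=
      squeeze_zero (fun _ => h.halfSin_nonneg _ _) (fun _ => h.halfSin_le _ _)
        (by simpa using hd.const_mul (Real.pi / D / 2))
    have h1 : Tendsto (fun i => Real.exp
        (-2 * gromovProd (c z₀ 0) (c (z i) (t i)) (c (z' i) (t' i)))) l (nhds 0) := by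
      simpa using hE.add (h3.pow 2)
    rw [Real.tendsto_exp_comp_nhds_zero] at h1
    refine (h1.const_mul_atBot_of_neg (r := -1 / 2) (by norm_num)).congr fun i => ?_
    ring

open Classical in
/-- The limit of Gromov products along sequences converging radially to two directions. -/
lemma tendsto_ofReal_gromovProd (h : IsHyperbolicCone D c) (z₀ : Z)
    (h0 : ∀ i, 0 ≤ t i) (h0' : ∀ i, 0 ≤ t' i)
    (ht : Tendsto t l atTop) (ht' : Tendsto t' l atTop) {a b : Z}
    (hz : Tendsto z l (nhds a)) (hz' : Tendsto z' l (nhds b)) :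
    Tendsto (fun i => ENNReal.ofReal
      (gromovProd (c z₀ 0) (c (z i) (t i)) (c (z' i) (t' i)))) l
      (nhds (if a = b then ⊤ else ENNReal.ofReal (-Real.log (halfSin D a b)))) := by
  have hd := hz.dist hz'
  split_ifs with hab
  · subst hab
    rw [dist_self] at hd
    exact ENNReal.tendsto_ofReal_atTop.comp
      ((h.tendsto_gromovProd_atTop_iff z₀ h0 h0' ht ht').2 hd)
  · refine ENNReal.tendsto_ofReal ?_
    have hE := h.tendsto_exp_gromovProd_sub (z := z) (z' := z') z₀ h0 h0' ht ht'
    have hs : Tendsto (fun i => halfSin D (z i) (z' i)) l (nhds (halfSin D a b)) :=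
      (Real.continuous_sin.tendsto _).comp ((hd.const_mul _).div_const 2)
    have hpos : 0 < halfSin D a b := by
      have h1 := h.dist_le_mul_halfSin a b
      have h2 := dist_pos.2 hab
      exact pos_of_mul_pos_right (h2.trans_le h1) h.pos.le
    have h1 := hE.add (hs.pow 2)
    simp only [sub_add_cancel, zero_add] at h1
    have h2 := (h1.log (by positivity)).const_mul (-1 / 2)
    simp only [Real.log_exp, Real.log_pow] at h2
    convert h2 using 2 <;> push_cast <;> ring

end Limits

/-- The angular coordinate of a point of the cone. -/
def dir (h : IsHyperbolicCone D c) (y : Y) : Z := (h.surj y).choose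

lemma coord_dir (h : IsHyperbolicCone D c) (z₀ : Z) (y : Y) :
    c (h.dir y) (dist y (c z₀ 0)) = y := by
  obtain ⟨ht, e⟩ := (h.surj y).choose_spec.choose_spec
  conv_rhs => rw [← e]
  rw [dir]
  congr 1
  conv_lhs => rw [← e]
  exact h.dist_vertex _ _ ht

lemma tendsto_gromovProd_atTop_iff_dir (h : IsHyperbolicCone D c) (z₀ : Z) {α : Type*}
    {l : Filter α} {f g : α → Y} (hf : Tendsto (fun i => dist (f i) (c z₀ 0)) l atTop)
    (hg : Tendsto (fun i => dist (g i) (c z₀ 0)) l atTop) :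
    Tendsto (fun i => gromovProd (c z₀ 0) (f i) (g i)) l atTop ↔
      Tendsto (fun i => dist (h.dir (f i)) (h.dir (g i))) l (nhds 0) := by
  simpa only [h.coord_dir] using h.tendsto_gromovProd_atTop_iff
    (z := fun i => h.dir (f i)) (z' := fun i => h.dir (g i)) z₀
    (fun _ => dist_nonneg) (fun _ => dist_nonneg) hf hg

lemma tendsto_dist_of_convInf {X : Type*} [MetricSpace X] {o : X} {u : ℕ → X}
    (hu : ConvInf o u) : Tendsto (fun i => dist (u i) o) atTop atTop := by
  have : Tendsto (fun i : ℕ => (i, i)) atTop atTop := by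
    rw [← prod_atTop_atTop_eq]
    exact tendsto_id.prodMk tendsto_id
  simpa only [Function.comp_def, gromovProd_self] using hu.comp this

lemma cauchySeq_dir (h : IsHyperbolicCone D c) (z₀ : Z) {u : ℕ → Y}
    (hu : ConvInf (c z₀ 0) u) : CauchySeq (fun i => h.dir (u i)) := by
  have ht := tendsto_dist_of_convInf hu
  rw [cauchySeq_iff_tendsto_dist_atTop_0]
  refine (h.tendsto_gromovProd_atTop_iff_dir z₀ (f := fun p : ℕ × ℕ => u p.1)
    (g := fun p : ℕ × ℕ => u p.2) ?_ ?_).1 hu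
  · rw [← prod_atTop_atTop_eq]; exact ht.comp tendsto_fst
  · rw [← prod_atTop_atTop_eq]; exact ht.comp tendsto_snd

lemma bdryRel_iff (h : IsHyperbolicCone D c) (z₀ : Z) (u v : {u : ℕ → Y // ConvInf (c z₀ 0) u}) :
    BdryRel (c z₀ 0) u v ↔
      Tendsto (fun i => dist (h.dir (u.1 i)) (h.dir (v.1 i))) atTop (nhds 0) :=
  h.tendsto_gromovProd_atTop_iff_dir z₀ (tendsto_dist_of_convInf u.2)
    (tendsto_dist_of_convInf v.2)

lemma bdryRel_equivalence (h : IsHyperbolicCone D c) (z₀ : Z) :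
    Equivalence (BdryRel (c z₀ 0)) where
  refl u := by simp [h.bdryRel_iff]
  symm {u v} huv := by
    rw [h.bdryRel_iff] at *
    simpa only [dist_comm] using huv
  trans {u v w} huv hvw := by
    rw [h.bdryRel_iff] at *
    exact squeeze_zero (fun _ => dist_nonneg) (fun _ => dist_triangle _ _ _)
      (by simpa using huv.add hvw)

lemma mk_eq_mk_iff (h : IsHyperbolicCone D c) (z₀ : Z)
    (u v : {u : ℕ → Y // ConvInf (c z₀ 0) u}) :
    Quot.mk (BdryRel (c z₀ 0)) u = Quot.mk (BdryRel (c z₀ 0)) v ↔ BdryRel (c z₀ 0) u v := by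
  rw [Quot.eq, (h.bdryRel_equivalence z₀).eqvGen_iff]

lemma convInf_ray (h : IsHyperbolicCone D c) (z₀ z : Z) :
    ConvInf (c z₀ 0) (fun n : ℕ => c z (n : ℝ)) := by
  refine (h.tendsto_gromovProd_atTop_iff (z := fun _ => z) (z' := fun _ => z)
    (t := fun p : ℕ × ℕ => (p.1 : ℝ)) (t' := fun p : ℕ × ℕ => (p.2 : ℝ)) z₀
    (fun _ => Nat.cast_nonneg _) (fun _ => Nat.cast_nonneg _) ?_ ?_).2 (by simp)
  · rw [← prod_atTop_atTop_eq]; exact tendsto_natCast_atTop_atTop.comp tendsto_fst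
  · rw [← prod_atTop_atTop_eq]; exact tendsto_natCast_atTop_atTop.comp tendsto_snd

/-- The boundary point represented by the ray in direction `z`. -/
def rayBdry (h : IsHyperbolicCone D c) (z₀ z : Z) : Bdry Y (c z₀ 0) :=
  Quot.mk _ ⟨fun n : ℕ => c z (n : ℝ), h.convInf_ray z₀ z⟩

lemma mk_eq_rayBdry_iff (h : IsHyperbolicCone D c) (z₀ z : Z)
    (u : {u : ℕ → Y // ConvInf (c z₀ 0) u}) :
    Quot.mk (BdryRel (c z₀ 0)) u = h.rayBdry z₀ z ↔
      Tendsto (fun i => h.dir (u.1 i)) atTop (nhds z) := by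
  rw [rayBdry, h.mk_eq_mk_iff, tendsto_iff_dist_tendsto_zero]
  simpa only [h.coord_dir, BdryRel] using h.tendsto_gromovProd_atTop_iff
    (z := fun i => h.dir (u.1 i)) (z' := fun _ => z) (t' := fun n : ℕ => (n : ℝ)) z₀
    (fun _ => dist_nonneg) (fun _ => Nat.cast_nonneg _)
    (tendsto_dist_of_convInf u.2) tendsto_natCast_atTop_atTop

lemma rayBdry_injective (h : IsHyperbolicCone D c) (z₀ : Z) :
    Function.Injective (h.rayBdry z₀) := fun z z' e =>
  tendsto_nhds_unique ((h.mk_eq_rayBdry_iff z₀ z ⟨_, h.convInf_ray z₀ z⟩).1 rfl)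
    ((h.mk_eq_rayBdry_iff z₀ z' ⟨_, h.convInf_ray z₀ z⟩).1 e)

lemma rayBdry_surjective (h : IsHyperbolicCone D c) (z₀ : Z) [CompleteSpace Z] :
    Function.Surjective (h.rayBdry z₀) := by
  rintro ⟨u⟩
  obtain ⟨z, hz⟩ := cauchySeq_tendsto_of_complete (h.cauchySeq_dir z₀ u.2)
  exact ⟨z, ((h.mk_eq_rayBdry_iff z₀ z u).2 hz).symm⟩

open Classical in
lemma gpBdry_rayBdry (h : IsHyperbolicCone D c) (z₀ a b : Z) :
    gpBdry (c z₀ 0) (h.rayBdry z₀ a) (h.rayBdry z₀ b) =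
      if a = b then ⊤ else ENNReal.ofReal (-Real.log (halfSin D a b)) := by
  have key : ∀ u v : {u : ℕ → Y // ConvInf (c z₀ 0) u},
      Quot.mk (BdryRel (c z₀ 0)) u = h.rayBdry z₀ a →
      Quot.mk (BdryRel (c z₀ 0)) v = h.rayBdry z₀ b →
      liminf (fun i => ENNReal.ofReal (gromovProd (c z₀ 0) (u.1 i) (v.1 i))) atTop =
        if a = b then ⊤ else ENNReal.ofReal (-Real.log (halfSin D a b)) := by
    intro u v hu hv
    rw [mk_eq_rayBdry_iff] at hu hv
    have := h.tendsto_ofReal_gromovProd z₀ (fun _ => dist_nonneg) (fun _ => dist_nonneg)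
      (tendsto_dist_of_convInf u.2) (tendsto_dist_of_convInf v.2) hu hv
    simp only [h.coord_dir] at this
    exact this.liminf_eq
  refine le_antisymm ?_ ?_
  · exact (iInf₂_le_of_le _ rfl (iInf₂_le_of_le _ rfl (key _ _ rfl rfl).le))
  · exact le_iInf₂ fun u hu => le_iInf₂ fun v hv => (key u v hu hv).ge

lemma visualGauge_gpBdry (h : IsHyperbolicCone D c) (z₀ a b : Z) :
    visualGauge (Real.exp 1) (gpBdry (c z₀ 0) (h.rayBdry z₀ a) (h.rayBdry z₀ b)) =
      ENNReal.ofReal (halfSin D a b) := by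
  rw [h.gpBdry_rayBdry, visualGauge]
  by_cases h1 : a = b
  · simp [h1, halfSin]
  · rw [if_neg h1, if_neg ENNReal.ofReal_ne_top]
    have hpos : 0 < halfSin D a b :=
      pos_of_mul_pos_right ((dist_pos.2 h1).trans_le (h.dist_le_mul_halfSin a b)) h.pos.le
    have hle : halfSin D a b ≤ 1 := Real.sin_le_one _
    rw [ENNReal.toReal_ofReal (by linarith [Real.log_nonpos hpos.le hle]), neg_neg,
      Real.exp_one_rpow, Real.exp_log hpos]

end IsHyperbolicCone

lemma Real.sin_two_mul_le_two_mul_tan {x : ℝ} (h0 : 0 ≤ x) (h1 : x < Real.pi / 2) :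
    Real.sin (2 * x) ≤ 2 * Real.tan x := by
  have hc : 0 < Real.cos x := Real.cos_pos_of_mem_Ioo ⟨by linarith, h1⟩
  have hs : 0 ≤ Real.sin x := Real.sin_nonneg_of_nonneg_of_le_pi h0 (by linarith)
  rw [Real.sin_two_mul, Real.tan_eq_sin_div_cos, ← mul_div_assoc, le_div_iff₀ hc]
  nlinarith [Real.cos_le_one x, mul_nonneg hs (sub_nonneg.2 (Real.cos_sq_le_one x))]

lemma Real.tan_le_sin_two_mul {x : ℝ} (h0 : 0 ≤ x) (h1 : x ≤ Real.pi / 4) :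
    Real.tan x ≤ Real.sin (2 * x) := by
  have hpi := Real.pi_pos
  have hc : 0 < Real.cos x := Real.cos_pos_of_mem_Ioo ⟨by linarith, by linarith⟩
  have hs : 0 ≤ Real.sin x := Real.sin_nonneg_of_nonneg_of_le_pi h0 (by linarith)
  have h2 : 0 ≤ Real.cos (2 * x) :=
    Real.cos_nonneg_of_mem_Icc ⟨by linarith, by linarith⟩
  rw [Real.cos_two_mul] at h2
  rw [Real.sin_two_mul, Real.tan_eq_sin_div_cos, div_le_iff₀ hc]
  nlinarith

/-- A hyperbolicity constant `δ` of the hyperbolic plane satisfies `3δ ≥ log 2`. -/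
lemma exp_neg_three_mul_le_half {δ : ℝ}
    (hH2 : ∀ o x y z : UpperHalfPlane,
      min (gromovProd o x y) (gromovProd o y z) - δ ≤ gromovProd o x z) :
    Real.exp (-3 * δ) ≤ 1 / 2 := by
  let x : UpperHalfPlane := ⟨⟨0, 3⟩, by norm_num⟩
  let z : UpperHalfPlane := ⟨⟨0, 1 / 3⟩, by norm_num⟩
  let o : UpperHalfPlane := ⟨⟨4 / 5, 3 / 5⟩, by norm_num⟩
  let y : UpperHalfPlane := ⟨⟨-4 / 5, 3 / 5⟩, by norm_num⟩
  have cosh_dist : ∀ p q : UpperHalfPlane, Real.cosh (dist p q) =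
      1 + ((p.re - q.re) ^ 2 + (p.im - q.im) ^ 2) / (2 * p.im * q.im) := by
    intro p q
    rw [UpperHalfPlane.cosh_dist, Complex.dist_eq, Complex.sq_norm, Complex.normSq_apply]
    simp [pow_two]
  have diag : ∀ p q : UpperHalfPlane, Real.cosh (dist p q) = 41 / 9 →
      dist p q = Real.log 9 := by
    intro p q hpq
    have h9 : Real.cosh (Real.log 9) = 41 / 9 := by
      rw [Real.cosh_log (by norm_num)]; norm_num
    exact Real.cosh_injOn (mem_Ici.2 dist_nonneg) (mem_Ici.2 (Real.log_nonneg (by norm_num)))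
      (hpq.trans h9.symm)
  have side : ∀ p q : UpperHalfPlane, Real.cosh (dist p q) = 25 / 9 →
      dist p q ≤ Real.log (50 / 9) := by
    intro p q hpq
    rw [Real.le_log_iff_exp_le (by norm_num)]
    rw [Real.cosh_eq] at hpq
    linarith [Real.exp_pos (-dist p q)]
  have hxz : dist x z = Real.log 9 := diag _ _ (by
    rw [cosh_dist]; simp only [UpperHalfPlane.re, UpperHalfPlane.im, x, z]; norm_num)
  have hyo : dist y o = Real.log 9 := diag _ _ (by
    rw [cosh_dist]; simp only [UpperHalfPlane.re, UpperHalfPlane.im, y, o]; norm_num)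
  have hxo : dist x o ≤ Real.log (50 / 9) := side _ _ (by
    rw [cosh_dist]; simp only [UpperHalfPlane.re, UpperHalfPlane.im, x, o]; norm_num)
  have hzo : dist z o ≤ Real.log (50 / 9) := side _ _ (by
    rw [cosh_dist]; simp only [UpperHalfPlane.re, UpperHalfPlane.im, z, o]; norm_num)
  have hxy : dist x y ≤ Real.log (50 / 9) := side _ _ (by
    rw [cosh_dist]; simp only [UpperHalfPlane.re, UpperHalfPlane.im, x, y]; norm_num)
  have hyz : dist y z ≤ Real.log (50 / 9) := side _ _ (by
    rw [cosh_dist]; simp only [UpperHalfPlane.re, UpperHalfPlane.im, y, z]; norm_num)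
  have hδ : Real.log 9 - Real.log (50 / 9) ≤ δ := by
    have h := hH2 o x y z
    unfold gromovProd at h
    rcases min_choice ((dist x o + dist y o - dist x y) / 2)
      ((dist y o + dist z o - dist y z) / 2) with hm | hm <;> rw [hm] at h <;> linarith
  rw [← Real.log_div (by norm_num) (by norm_num)] at hδ
  calc Real.exp (-3 * δ) ≤ Real.exp (-(3 * Real.log (9 / (50 / 9)))) :=
        Real.exp_le_exp.2 (by linarith)
    _ = ((9 / (50 / 9) : ℝ) ^ 3)⁻¹ := by
        rw [Real.exp_neg, mul_comm, Real.exp_mul, Real.exp_log (by norm_num)]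
        norm_cast
    _ ≤ 1 / 2 := by norm_num

open Real in
/-- **Proposition 6.1 (second part).** Let `Z` be a bounded metric space with
`diam Z > 0` and `Y = Co(Z)` its hyperbolic cone with vertex `o = c z₀ 0`. Each
`z ∈ Z` determines, via the geodesic ray `{z} × [0,∞)`, a boundary point `ι z ∈ ∂∞Y`,
and this gives a canonical inclusion `ι : Z → ∂∞Y`. For all `z, z' ∈ Z` one has
`e^{-3δ}·e^{-(z|z')_o} ≤ tan(μ|zz'|/4) ≤ e^{-(z|z')_o}` (`δ = δ(H²)`, `μ = π/diam Z`);
consequently the metric of `Z` is a visual metric w.r.t. `o` and the parameter `a = e`.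
Moreover, if `Z` is complete then `∂∞Y = Z`. -/
theorem hyperbolicCone_boundary_visual
    {Z : Type u} [MetricSpace Z] [Nonempty Z]
    (hbdd : Bornology.IsBounded (univ : Set Z))
    (hdiam : 0 < Metric.diam (univ : Set Z))
    {Y : Type v} [MetricSpace Y] (c : Z → ℝ → Y)
    (hsurj : ∀ y : Y, ∃ z t, 0 ≤ t ∧ c z t = y)
    (hformula : ∀ (z z' : Z) (t t' : ℝ), 0 ≤ t → 0 ≤ t' →
      Real.cosh (dist (c z t) (c z' t')) =
        Real.cosh t * Real.cosh t' -
          Real.sinh t * Real.sinh t' *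
            Real.cos (π / Metric.diam (univ : Set Z) * dist z z'))
    (δ : ℝ) (hδ : 0 ≤ δ)
    (hH2 : ∀ o x y z : UpperHalfPlane,
      min (gromovProd o x y) (gromovProd o y z) - δ ≤ gromovProd o x z)
    (z₀ : Z) :
    (∀ z : Z, ConvInf (c z₀ 0) (fun n : ℕ => c z (n : ℝ))) ∧
    ∃ ι : Z → Bdry Y (c z₀ 0),
      (∀ (z : Z) (h : ConvInf (c z₀ 0) (fun n : ℕ => c z (n : ℝ))),
        ι z = Quot.mk (BdryRel (c z₀ 0)) ⟨fun n : ℕ => c z (n : ℝ), h⟩) ∧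
      Function.Injective ι ∧
      (∀ z z' : Z,
        ENNReal.ofReal (Real.exp (-3 * δ)) *
            visualGauge (Real.exp 1) (gpBdry (c z₀ 0) (ι z) (ι z')) ≤
          ENNReal.ofReal
            (Real.tan (π / Metric.diam (univ : Set Z) * dist z z' / 4)) ∧
        ENNReal.ofReal
            (Real.tan (π / Metric.diam (univ : Set Z) * dist z z' / 4)) ≤
          visualGauge (Real.exp 1) (gpBdry (c z₀ 0) (ι z) (ι z'))) ∧
      (∃ c₁ c₂ : ℝ, 0 < c₁ ∧ 0 < c₂ ∧ ∀ z z' : Z,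
        ENNReal.ofReal c₁ * visualGauge (Real.exp 1) (gpBdry (c z₀ 0) (ι z) (ι z')) ≤
            edist z z' ∧
          edist z z' ≤
            ENNReal.ofReal c₂ *
              visualGauge (Real.exp 1) (gpBdry (c z₀ 0) (ι z) (ι z'))) ∧
      (CompleteSpace Z → Function.Surjective ι) := by
  have h : IsHyperbolicCone (Metric.diam (univ : Set Z)) c :=
    ⟨hdiam, fun z z' => Metric.dist_le_diam_of_mem hbdd (mem_univ z) (mem_univ z'),
      hsurj, hformula⟩
  refine ⟨h.convInf_ray z₀, h.rayBdry z₀, fun _ _ => rfl, h.rayBdry_injective z₀, ?_, ?_,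
    fun _ => h.rayBdry_surjective z₀⟩
  · intro z z'
    have h0 := h.angle_nonneg z z'
    have h1 := h.angle_le_pi z z'
    have hpi := Real.pi_pos
    rw [h.visualGauge_gpBdry, ← ENNReal.ofReal_mul (Real.exp_pos _).le,
      IsHyperbolicCone.halfSin]
    set θ := π / Metric.diam (univ : Set Z) * dist z z'
    rw [show θ / 2 = 2 * (θ / 4) by ring]
    constructor <;> refine ENNReal.ofReal_le_ofReal ?_
    · have hs := Real.sin_two_mul_le_two_mul_tan (x := θ / 4) (by linarith) (by linarith)
      have hs0 : 0 ≤ Real.sin (2 * (θ / 4)) :=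
        Real.sin_nonneg_of_nonneg_of_le_pi (by linarith) (by linarith)
      nlinarith [exp_neg_three_mul_le_half hH2]
    · exact Real.tan_le_sin_two_mul (by linarith) (by linarith)
  · have hpi := Real.pi_pos
    refine ⟨2 * Metric.diam (univ : Set Z) / π, Metric.diam (univ : Set Z), by positivity,
      hdiam, fun z z' => ?_⟩
    rw [h.visualGauge_gpBdry, edist_dist, ← ENNReal.ofReal_mul (by positivity),
      ← ENNReal.ofReal_mul hdiam.le]
    refine ⟨ENNReal.ofReal_le_ofReal ?_, ENNReal.ofReal_le_ofReal (h.dist_le_mul_halfSin z z')⟩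
    calc 2 * Metric.diam (univ : Set Z) / π * IsHyperbolicCone.halfSin _ z z'
        ≤ 2 * Metric.diam (univ : Set Z) / π *
          (π / Metric.diam (univ : Set Z) / 2 * dist z z') := by
          gcongr; exact h.halfSin_le z z'
      _ = dist z z' := by field_simp
end
end
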